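/- Assume conditions (V) and (Q) with N < α < β, and let 2 ≤ p ≤ p̄, where p̄ := min{ 2(β−N)/(α−N), 2*_γ }. Then there exists a constant C > 0 such that for every u ∈ C_c^∞(ℝ^N), (∫_{ℝ^N} Q(z)|u|^p dz)^{1/p} ≤ C ‖u‖_{E_V^γ}; that is, the embedding E_V^γ ↪ L^p_Q(ℝ^N) is continuous. -/

import Mathlib

open MeasureTheory Filter

noncomputable section

/-- `ℝ^m` with its Euclidean structure. -/
abbrev Em (m : ℕ) : Type := EuclideanSpace ℝ (Fin m)

/-- Gradient in the `x`-variables. -/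
noncomputable def gradX {m k : ℕ} (u : Em m × Em k → ℝ) (z : Em m × Em k) : Em m :=
  gradient (fun x => u (x, z.2)) z.1

/-- Gradient in the `y`-variables. -/
noncomputable def gradY {m k : ℕ} (u : Em m × Em k → ℝ) (z : Em m × Em k) : Em k :=
  gradient (fun y => u (z.1, y)) z.2

/-- The Grushin gradient `∇_γ u (x,y) = (∇_x u, |x|^γ ∇_y u)`. -/
noncomputable def grushinGrad {m k : ℕ} (γ : ℝ) (u : Em m × Em k → ℝ) (z : Em m × Em k) :
    Em m × Em k :=
  (gradX u z, ‖z.1‖ ^ γ • gradY u z)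

/-- `|∇_γ u|² = |∇_x u|² + |x|^{2γ} |∇_y u|²`. -/
noncomputable def grushinSq {m k : ℕ} (γ : ℝ) (u : Em m × Em k → ℝ) (z : Em m × Em k) : ℝ :=
  ‖gradX u z‖ ^ 2 + ‖z.1‖ ^ (2 * γ) * ‖gradY u z‖ ^ 2

/-- The Euclidean norm of `z = (x,y) ∈ ℝ^m × ℝ^k ≅ ℝ^N`. -/
noncomputable def pnorm {m k : ℕ} (z : Em m × Em k) : ℝ :=
  Real.sqrt (‖z.1‖ ^ 2 + ‖z.2‖ ^ 2)

/-- The Euclidean ball `B_R = {z : |z| < R}` in `ℝ^m × ℝ^k ≅ ℝ^N`. -/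
def pball (m k : ℕ) (R : ℝ) : Set (Em m × Em k) := {z | pnorm z < R}

/-- The critical exponent `2*_γ = 2 N_γ / (N_γ - 2)`, `N_γ = m + (γ+1)k`. -/
noncomputable def twoStar (m k : ℕ) (γ : ℝ) : ℝ :=
  2 * ((m : ℝ) + (γ + 1) * k) / (((m : ℝ) + (γ + 1) * k) - 2)

/-- The norm of the space `E_V^γ`:
`‖u‖ = (∫ (|∇_γ u|² + V u²))^{1/2}` (with value `0` if the integral is infinite). -/
noncomputable def enormV {m k : ℕ} (γ : ℝ) (V u : Em m × Em k → ℝ) : ℝ :=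
  ((∫⁻ z, ENNReal.ofReal (grushinSq γ u z + V z * u z ^ 2)) ^ ((1:ℝ)/2)).toReal

theorem sq_sub_le_integral_sq_norm_gradient {F : Type*} [NormedAddCommGroup F]
    [InnerProductSpace ℝ F] [CompleteSpace F] {f : F → ℝ} (hf : ContDiff ℝ 1 f) (x h : F) :
    ENNReal.ofReal ((f (x + h) - f x) ^ 2) ≤
      ∫⁻ s in Set.Ioc (0 : ℝ) 1,
        ENNReal.ofReal (‖h‖ ^ 2) * ENNReal.ofReal (‖gradient f (x + s • h)‖ ^ 2) := by
  have hgc : Continuous (gradient f) :=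
    (InnerProductSpace.toDual ℝ F).symm.continuous.comp (hf.continuous_fderiv one_ne_zero)
  have hcc : Continuous fun s : ℝ => ‖h‖ * ‖gradient f (x + s • h)‖ := by fun_prop
  have hder : ∀ s : ℝ, HasDerivAt (fun s : ℝ => f (x + s • h))
      (inner ℝ (gradient f (x + s • h)) h) s := by
    intro s
    have h1 := ((hf.differentiable one_ne_zero) (x + s • h)).hasGradientAt.hasFDerivAt
    have h2 : HasDerivAt (fun s : ℝ => x + s • h) h s := by
      simpa using ((hasDerivAt_id s).smul_const h).const_add x
    have h3 := h1.comp_hasDerivAt s h2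
    rwa [InnerProductSpace.toDual_apply_apply] at h3
  have hinner : Continuous fun s : ℝ => inner ℝ (gradient f (x + s • h)) h := by fun_prop
  have hftc : f (x + h) - f x = ∫ s in (0 : ℝ)..1, inner ℝ (gradient f (x + s • h)) h := by
    rw [intervalIntegral.integral_eq_sub_of_hasDerivAt (fun s _ => hder s)
      (hinner.intervalIntegrable _ _)]
    simp
  have habs : ENNReal.ofReal |f (x + h) - f x| ≤
      ∫⁻ s in Set.Ioc (0 : ℝ) 1, ENNReal.ofReal (‖h‖ * ‖gradient f (x + s • h)‖) := by
    rw [← ofReal_integral_eq_lintegral_ofReal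
      ((hcc.intervalIntegrable 0 1).1) (Eventually.of_forall fun s => by positivity)]
    apply ENNReal.ofReal_le_ofReal
    rw [hftc, ← Real.norm_eq_abs, ← intervalIntegral.integral_of_le zero_le_one]
    apply intervalIntegral.norm_integral_le_of_norm_le zero_le_one
    · exact Eventually.of_forall fun s _ => by
        rw [mul_comm]; exact norm_inner_le_norm _ _
    · exact hcc.intervalIntegrable _ _
  have hH := ENNReal.lintegral_mul_le_Lp_mul_Lq (volume.restrict (Set.Ioc (0 : ℝ) 1))
    Real.HolderConjugate.two_two
    (f := fun s => ENNReal.ofReal (‖h‖ * ‖gradient f (x + s • h)‖)) (g := fun _ => 1)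
    (hcc.measurable.ennreal_ofReal.aemeasurable) aemeasurable_const
  simp only [Pi.mul_apply, mul_one, ENNReal.one_rpow, lintegral_const,
    Measure.restrict_apply MeasurableSet.univ, Set.univ_inter, Real.volume_Ioc, sub_zero,
    ENNReal.ofReal_one] at hH
  have h3 := habs.trans hH
  rw [one_div, ENNReal.le_rpow_inv_iff two_pos] at h3
  simp only [ENNReal.rpow_two] at h3
  rw [← sq_abs, ENNReal.ofReal_pow (abs_nonneg _)]
  refine h3.trans (lintegral_mono fun s => ?_)
  rw [← ENNReal.ofReal_pow (by positivity), mul_pow, ENNReal.ofReal_mul (by positivity)]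

theorem lintegral_sq_translate_sub_le {F : Type*} [NormedAddCommGroup F]
    [InnerProductSpace ℝ F] [FiniteDimensional ℝ F] [MeasurableSpace F] [BorelSpace F]
    {f : F → ℝ} (hf : ContDiff ℝ 1 f) (h : F) :
    ∫⁻ x, ENNReal.ofReal ((f (x + h) - f x) ^ 2) ≤
      ENNReal.ofReal (‖h‖ ^ 2) * ∫⁻ x, ENNReal.ofReal (‖gradient f x‖ ^ 2) := by
  have hgc : Continuous (gradient f) :=
    (InnerProductSpace.toDual ℝ F).symm.continuous.comp (hf.continuous_fderiv one_ne_zero)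
  have hm : Measurable fun q : F × ℝ =>
      ENNReal.ofReal (‖h‖ ^ 2) * ENNReal.ofReal (‖gradient f (q.1 + q.2 • h)‖ ^ 2) := by
    have : Continuous fun q : F × ℝ => ‖gradient f (q.1 + q.2 • h)‖ ^ 2 := by fun_prop
    exact measurable_const.mul this.measurable.ennreal_ofReal
  calc _ ≤ ∫⁻ x, ∫⁻ s in Set.Ioc (0 : ℝ) 1,
        ENNReal.ofReal (‖h‖ ^ 2) * ENNReal.ofReal (‖gradient f (x + s • h)‖ ^ 2) :=
        lintegral_mono fun x => sq_sub_le_integral_sq_norm_gradient hf x h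
    _ = ∫⁻ s in Set.Ioc (0 : ℝ) 1, ∫⁻ x : F,
        ENNReal.ofReal (‖h‖ ^ 2) * ENNReal.ofReal (‖gradient f (x + s • h)‖ ^ 2) :=
        lintegral_lintegral_swap hm.aemeasurable
    _ = ∫⁻ s in Set.Ioc (0 : ℝ) 1, ∫⁻ x : F,
        ENNReal.ofReal (‖h‖ ^ 2) * ENNReal.ofReal (‖gradient f x‖ ^ 2) := by
        congr 1 with s
        exact lintegral_add_right_eq_self
          (fun x => ENNReal.ofReal (‖h‖ ^ 2) * ENNReal.ofReal (‖gradient f x‖ ^ 2)) (s • h)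
    _ = _ := by
        rw [lintegral_const, Measure.restrict_apply MeasurableSet.univ, Set.univ_inter,
          Real.volume_Ioc, sub_zero, ENNReal.ofReal_one, mul_one,
          lintegral_const_mul' _ _ ENNReal.ofReal_ne_top]

section Grushin

variable {m k : ℕ} {u : Em m × Em k → ℝ}

theorem contDiff_slice_fst (hu : ContDiff ℝ 1 u) (y : Em k) :
    ContDiff ℝ 1 fun x => u (x, y) :=
  hu.comp (contDiff_id.prodMk contDiff_const)

theorem contDiff_slice_snd (hu : ContDiff ℝ 1 u) (x : Em m) :
    ContDiff ℝ 1 fun y => u (x, y) :=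
  hu.comp (contDiff_const.prodMk contDiff_id)

theorem continuous_gradX (hu : ContDiff ℝ 1 u) : Continuous (gradX u) := by
  have h : gradX u = fun z => (InnerProductSpace.toDual ℝ (Em m)).symm
      ((fderiv ℝ u z).comp (ContinuousLinearMap.inl ℝ (Em m) (Em k))) := by
    funext z
    have h1 : HasFDerivAt (fun x => u (x, z.2)) _ z.1 :=
      (hu.differentiable one_ne_zero z).hasFDerivAt.comp z.1 (hasFDerivAt_prodMk_left z.1 z.2)
    rw [gradX, gradient, h1.fderiv]
  rw [h]
  exact (InnerProductSpace.toDual ℝ (Em m)).symm.continuous.comp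
    ((hu.continuous_fderiv one_ne_zero).clm_comp continuous_const)

theorem continuous_gradY (hu : ContDiff ℝ 1 u) : Continuous (gradY u) := by
  have h : gradY u = fun z => (InnerProductSpace.toDual ℝ (Em k)).symm
      ((fderiv ℝ u z).comp (ContinuousLinearMap.inr ℝ (Em m) (Em k))) := by
    funext z
    have h1 : HasFDerivAt (fun y => u (z.1, y)) _ z.2 :=
      (hu.differentiable one_ne_zero z).hasFDerivAt.comp z.2 (hasFDerivAt_prodMk_right z.1 z.2)
    rw [gradY, gradient, h1.fderiv]
  rw [h]
  exact (InnerProductSpace.toDual ℝ (Em k)).symm.continuous.comp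
    ((hu.continuous_fderiv one_ne_zero).clm_comp continuous_const)

theorem grushinSq_nonneg (γ : ℝ) (u : Em m × Em k → ℝ) (z : Em m × Em k) :
    0 ≤ grushinSq γ u z := by
  unfold grushinSq; positivity

theorem measurable_grushinSq (γ : ℝ) (hu : ContDiff ℝ 1 u) : Measurable (grushinSq γ u) := by
  have h1 := (continuous_gradX hu).measurable
  have h2 := (continuous_gradY hu).measurable
  unfold grushinSq
  fun_prop

theorem lintegral_sq_translate_fst_sub_le (hu : ContDiff ℝ 1 u) (t : Em m) :
    ∫⁻ z, ENNReal.ofReal ((u (z.1 + t, z.2) - u z) ^ 2) ≤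
      ENNReal.ofReal (‖t‖ ^ 2) * ∫⁻ z, ENNReal.ofReal (‖gradX u z‖ ^ 2) := by
  have hc := hu.continuous
  have hg := continuous_gradX hu
  have hm : Measurable fun z : Em m × Em k => ENNReal.ofReal ((u (z.1 + t, z.2) - u z) ^ 2) := by
    have : Continuous fun z : Em m × Em k => (u (z.1 + t, z.2) - u z) ^ 2 := by fun_prop
    exact this.measurable.ennreal_ofReal
  have hm2 : Measurable fun z : Em m × Em k => ENNReal.ofReal (‖gradX u z‖ ^ 2) := by
    have : Continuous fun z : Em m × Em k => ‖gradX u z‖ ^ 2 := by fun_prop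
    exact this.measurable.ennreal_ofReal
  rw [Measure.volume_eq_prod, lintegral_prod_symm _ hm.aemeasurable,
    lintegral_prod_symm _ hm2.aemeasurable, ← lintegral_const_mul' _ _ ENNReal.ofReal_ne_top]
  exact lintegral_mono fun y => lintegral_sq_translate_sub_le (contDiff_slice_fst hu y) t

/-- A vertical translation after a horizontal one that leads away from the degenerate set. -/
theorem setLIntegral_sq_translate_snd_sub_le (hu : ContDiff ℝ 1 u) {γ r : ℝ} (hγ : 0 < γ)
    (hr : 0 < r) {H : Set (Em m)} (hH : MeasurableSet H) {t : Em m}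
    (ht : ∀ x ∈ H, r ≤ ‖x + t‖) (v : Em k) :
    ∫⁻ z in H ×ˢ Set.univ, ENNReal.ofReal ((u (z.1 + t, z.2 + v) - u (z.1 + t, z.2)) ^ 2) ≤
      ENNReal.ofReal (‖v‖ ^ 2 / r ^ (2 * γ)) *
        ∫⁻ z : Em m × Em k, ENNReal.ofReal (‖z.1‖ ^ (2 * γ) * ‖gradY u z‖ ^ 2) := by
  have hc := hu.continuous
  have hg := continuous_gradY hu
  set c := ENNReal.ofReal (‖v‖ ^ 2 / r ^ (2 * γ))
  have hm : Measurable fun z : Em m × Em k =>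
      ENNReal.ofReal ((u (z.1 + t, z.2 + v) - u (z.1 + t, z.2)) ^ 2) := by
    have : Continuous fun z : Em m × Em k =>
      (u (z.1 + t, z.2 + v) - u (z.1 + t, z.2)) ^ 2 := by fun_prop
    exact this.measurable.ennreal_ofReal
  have hm2 : Measurable fun z : Em m × Em k =>
      ENNReal.ofReal (‖z.1‖ ^ (2 * γ) * ‖gradY u z‖ ^ 2) := by
    have := hg.measurable
    fun_prop
  have hpt : ∀ x ∈ H, ∫⁻ y, ENNReal.ofReal ((u (x + t, y + v) - u (x + t, y)) ^ 2) ≤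
      c * ∫⁻ y, ENNReal.ofReal (‖x + t‖ ^ (2 * γ) * ‖gradY u (x + t, y)‖ ^ 2) := by
    intro x hx
    refine (lintegral_sq_translate_sub_le (contDiff_slice_snd hu (x + t)) v).trans ?_
    rw [← lintegral_const_mul' _ _ ENNReal.ofReal_ne_top,
      ← lintegral_const_mul' _ _ ENNReal.ofReal_ne_top]
    refine lintegral_mono fun y => ?_
    rw [← ENNReal.ofReal_mul (by positivity), ← ENNReal.ofReal_mul (by positivity)]
    apply ENNReal.ofReal_le_ofReal
    have h1 : r ^ (2 * γ) ≤ ‖x + t‖ ^ (2 * γ) :=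
      Real.rpow_le_rpow hr.le (ht x hx) (by positivity)
    have h2 : 0 < r ^ (2 * γ) := Real.rpow_pos_of_pos hr _
    rw [← mul_assoc, div_mul_eq_mul_div]
    refine mul_le_mul_of_nonneg_right ?_ (by positivity)
    rw [le_div_iff₀ h2]
    exact mul_le_mul_of_nonneg_left h1 (by positivity)
  rw [Measure.volume_eq_prod, ← Measure.prod_restrict, Measure.restrict_univ,
    lintegral_prod _ hm.aemeasurable, lintegral_prod _ hm2.aemeasurable]
  calc _ ≤ ∫⁻ x in H, c * ∫⁻ y, ENNReal.ofReal (‖x + t‖ ^ (2 * γ) * ‖gradY u (x + t, y)‖ ^ 2) :=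
        setLIntegral_mono' hH hpt
    _ ≤ ∫⁻ x, c * ∫⁻ y, ENNReal.ofReal (‖x + t‖ ^ (2 * γ) * ‖gradY u (x + t, y)‖ ^ 2) :=
        setLIntegral_le_lintegral _ _
    _ = ∫⁻ x, c * ∫⁻ y, ENNReal.ofReal (‖x‖ ^ (2 * γ) * ‖gradY u (x, y)‖ ^ 2) :=
        lintegral_add_right_eq_self (fun x : Em m =>
          c * ∫⁻ y, ENNReal.ofReal (‖x‖ ^ (2 * γ) * ‖gradY u (x, y)‖ ^ 2)) t
    _ = _ := lintegral_const_mul' _ _ ENNReal.ofReal_ne_top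

theorem setLIntegral_sq_translate_sub_le (hu : ContDiff ℝ 1 u) {γ r : ℝ} (hγ : 0 < γ)
    (hr : 0 < r) {H : Set (Em m)} (hH : MeasurableSet H) {t : Em m}
    (ht : ∀ x ∈ H, r ≤ ‖x + t‖) (ht' : ‖t‖ ≤ 3 * r) {v : Em k} (hv : ‖v‖ ≤ r ^ (1 + γ)) :
    ∫⁻ z in H ×ˢ Set.univ, ENNReal.ofReal ((u (z + (t, v)) - u z) ^ 2) ≤
      ENNReal.ofReal (18 * r ^ 2) * ∫⁻ z, ENNReal.ofReal (grushinSq γ u z) := by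
  have hc := hu.continuous
  have hm : Measurable fun z : Em m × Em k =>
      ENNReal.ofReal 2 * ENNReal.ofReal ((u (z.1 + t, z.2) - u z) ^ 2) := by
    have : Continuous fun z : Em m × Em k => (u (z.1 + t, z.2) - u z) ^ 2 := by fun_prop
    exact measurable_const.mul this.measurable.ennreal_ofReal
  have hmX : Measurable fun z : Em m × Em k => ENNReal.ofReal (‖gradX u z‖ ^ 2) := by
    have := (continuous_gradX hu).measurable
    fun_prop
  have hv2 : ‖v‖ ^ 2 / r ^ (2 * γ) ≤ 9 * r ^ 2 := by
    have h2 : 0 < r ^ (2 * γ) := Real.rpow_pos_of_pos hr _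
    rw [div_le_iff₀ h2]
    have h3 : (r ^ (1 + γ)) ^ 2 = r ^ 2 * r ^ (2 * γ) := by
      rw [← Real.rpow_natCast, ← Real.rpow_mul hr.le, ← Real.rpow_natCast, ← Real.rpow_add hr]
      congr 1; push_cast; ring
    have h4 : ‖v‖ ^ 2 ≤ (r ^ (1 + γ)) ^ 2 := by gcongr
    nlinarith [mul_pos (pow_pos hr 2) h2]
  have ht2 : ‖t‖ ^ 2 ≤ 9 * r ^ 2 := by nlinarith [norm_nonneg t]
  calc _ ≤ ∫⁻ z in H ×ˢ Set.univ, (ENNReal.ofReal 2 * ENNReal.ofReal ((u (z.1 + t, z.2) - u z) ^ 2) +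
        ENNReal.ofReal 2 * ENNReal.ofReal ((u (z.1 + t, z.2 + v) - u (z.1 + t, z.2)) ^ 2)) := by
        refine lintegral_mono fun z => ?_
        rw [← mul_add, ← ENNReal.ofReal_add (by positivity) (by positivity),
          ← ENNReal.ofReal_mul (by norm_num)]
        apply ENNReal.ofReal_le_ofReal
        have : z + (t, v) = (z.1 + t, z.2 + v) := rfl
        rw [this]
        nlinarith [sq_nonneg ((u (z.1 + t, z.2) - u z) -
          (u (z.1 + t, z.2 + v) - u (z.1 + t, z.2)))]
    _ ≤ ENNReal.ofReal 2 * (ENNReal.ofReal (9 * r ^ 2) * ∫⁻ z, ENNReal.ofReal (‖gradX u z‖ ^ 2)) +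
        ENNReal.ofReal 2 * (ENNReal.ofReal (9 * r ^ 2) *
          ∫⁻ z : Em m × Em k, ENNReal.ofReal (‖z.1‖ ^ (2 * γ) * ‖gradY u z‖ ^ 2)) := by
        rw [lintegral_add_left hm, lintegral_const_mul' _ _ ENNReal.ofReal_ne_top,
          lintegral_const_mul' _ _ ENNReal.ofReal_ne_top]
        gcongr
        · refine (setLIntegral_le_lintegral _ _).trans
            ((lintegral_sq_translate_fst_sub_le hu t).trans ?_)
          gcongr
        · refine (setLIntegral_sq_translate_snd_sub_le hu hγ hr hH ht v).trans ?_
          gcongr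
    _ = _ := by
        rw [← mul_add, ← mul_add, ← lintegral_add_left hmX, ← mul_assoc,
          ← ENNReal.ofReal_mul (by norm_num)]
        congr 2
        · ring_nf
        · ext z
          rw [← ENNReal.ofReal_add (by positivity) (by positivity), grushinSq]

theorem measure_one_le_abs_inter_halfSpace_le (hu : ContDiff ℝ 1 u) {γ r : ℝ} (hγ : 0 < γ)
    (hr : 0 < r) {e : Em m} (he : ‖e‖ = 1)
    (hS : 2 * volume {z | u z ≠ 0} ≤ volume
      (Metric.ball ((2 * r) • e) r ×ˢ Metric.ball (0 : Em k) (r ^ (1 + γ)))) :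
    volume ({z | 1 ≤ |u z|} ∩ {x | 0 ≤ inner ℝ e x} ×ˢ Set.univ) ≤
      ENNReal.ofReal (36 * r ^ 2) * ∫⁻ z, ENNReal.ofReal (grushinSq γ u z) := by
  have hc := hu.continuous
  set B : Set (Em m × Em k) := Metric.ball ((2 * r) • e) r ×ˢ Metric.ball (0 : Em k) (r ^ (1 + γ))
    with hB
  set H : Set (Em m) := {x | 0 ≤ inner ℝ e x}
  set A : Set (Em m × Em k) := {z | 1 ≤ |u z|}
  have hBm : MeasurableSet B := Metric.isOpen_ball.measurableSet.prod Metric.isOpen_ball.measurableSet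
  have hBo : IsOpen B := Metric.isOpen_ball.prod Metric.isOpen_ball
  have hB0 : volume B ≠ 0 := by
    refine (hBo.measure_pos volume ⟨((2 * r) • e, 0), ?_⟩).ne'
    exact ⟨Metric.mem_ball_self hr, Metric.mem_ball_self (Real.rpow_pos_of_pos hr _)⟩
  have hBt : volume B ≠ ⊤ := by
    have : Bornology.IsBounded B := Metric.isBounded_ball.prod Metric.isBounded_ball
    exact this.measure_lt_top.ne
  have hHm : MeasurableSet H := measurableSet_le measurable_const (by fun_prop)
  have hAm : MeasurableSet A := measurableSet_le measurable_const (by fun_prop)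
  have hg : Measurable fun q : (Em m × Em k) × (Em m × Em k) =>
      ENNReal.ofReal ((u (q.1 + q.2) - u q.1) ^ 2) := by
    have : Continuous fun q : (Em m × Em k) × (Em m × Em k) => (u (q.1 + q.2) - u q.1) ^ 2 := by
      fun_prop
    exact this.measurable.ennreal_ofReal
  have hkey : ∀ z ∈ A, volume B ≤ 2 * ∫⁻ h in B, ENNReal.ofReal ((u (z + h) - u z) ^ 2) := by
    intro z hz
    set S : Set (Em m × Em k) := (fun h => z + h) ⁻¹' {z | u z ≠ 0} with hSdef
    have hSm : MeasurableSet S := by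
      have : Continuous fun h => u (z + h) := by fun_prop
      exact (this.measurable (measurableSet_singleton (0 : ℝ)).compl)
    have : (volume : Measure (Em m × Em k)).IsAddLeftInvariant :=
      inferInstanceAs (Measure.IsAddLeftInvariant (volume.prod volume))
    have hSv : volume S = volume {z | u z ≠ 0} := measure_preimage_add _ _ _
    have h1 : volume (B \ S) ≤ ∫⁻ h in B, ENNReal.ofReal ((u (z + h) - u z) ^ 2) := by
      rw [← setLIntegral_one]
      refine (setLIntegral_mono' (hBm.diff hSm) fun h hh => ?_).trans
        (lintegral_mono_set Set.sdiff_subset)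
      have h0 : u (z + h) = 0 := by simpa [hSdef] using hh.2
      rw [h0, ENNReal.one_le_ofReal, zero_sub, neg_sq, ← sq_abs]
      exact one_le_pow₀ hz
    have h2 : volume B ≤ volume S + volume (B \ S) :=
      (measure_le_inter_add_sdiff volume B S).trans (by gcongr; exact Set.inter_subset_right)
    have h3 : volume B + volume B ≤ volume B + 2 * volume (B \ S) := by
      calc volume B + volume B = 2 * volume B := (two_mul _).symm
        _ ≤ 2 * (volume S + volume (B \ S)) := by gcongr
        _ = 2 * volume S + 2 * volume (B \ S) := mul_add _ _ _
        _ ≤ _ := by rw [hSv]; gcongr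
    exact ((ENNReal.add_le_add_iff_left hBt).1 h3).trans (by gcongr)
  have hmain : volume (A ∩ H ×ˢ Set.univ) * volume B ≤
      (ENNReal.ofReal (36 * r ^ 2) * ∫⁻ z, ENNReal.ofReal (grushinSq γ u z)) * volume B := by
    calc volume (A ∩ H ×ˢ Set.univ) * volume B = ∫⁻ _ in A ∩ H ×ˢ Set.univ, volume B := by
          rw [setLIntegral_const, mul_comm]
      _ ≤ ∫⁻ z in A ∩ H ×ˢ Set.univ, 2 * ∫⁻ h in B, ENNReal.ofReal ((u (z + h) - u z) ^ 2) :=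
          setLIntegral_mono' (hAm.inter (hHm.prod MeasurableSet.univ)) fun z hz => hkey z hz.1
      _ ≤ ∫⁻ z in H ×ˢ Set.univ, 2 * ∫⁻ h in B, ENNReal.ofReal ((u (z + h) - u z) ^ 2) :=
          lintegral_mono_set Set.inter_subset_right
      _ = 2 * ∫⁻ h in B, ∫⁻ z in H ×ˢ Set.univ, ENNReal.ofReal ((u (z + h) - u z) ^ 2) := by
          rw [lintegral_const_mul' _ _ (by finiteness), lintegral_lintegral_swap hg.aemeasurable]
      _ ≤ 2 * ∫⁻ h in B, ENNReal.ofReal (18 * r ^ 2) *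
            ∫⁻ z, ENNReal.ofReal (grushinSq γ u z) := by
          gcongr 2 * ?_
          refine setLIntegral_mono' hBm fun h hh => ?_
          have hh1 : ‖h.1 - (2 * r) • e‖ < r := by simpa [dist_eq_norm] using hh.1
          have hh2 : ‖h.2‖ < r ^ (1 + γ) := by simpa using hh.2
          have hee : inner ℝ e e = (1 : ℝ) := by rw [real_inner_self_eq_norm_sq, he]; norm_num
          refine setLIntegral_sq_translate_sub_le hu hγ hr hHm (t := h.1) (v := h.2)
            (fun x hx => ?_) ?_ hh2.le
          · have h1 : inner ℝ e (x + h.1) ≤ ‖x + h.1‖ := by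
              simpa [he] using real_inner_le_norm e (x + h.1)
            have h2 : -‖h.1 - (2 * r) • e‖ ≤ inner ℝ e (h.1 - (2 * r) • e) := by
              have := neg_abs_le (inner ℝ e (h.1 - (2 * r) • e))
              have h4 := abs_real_inner_le_norm e (h.1 - (2 * r) • e)
              rw [he, one_mul] at h4
              linarith
            rw [inner_sub_right, inner_smul_right, hee] at h2
            rw [inner_add_right] at h1
            have hx' : 0 ≤ inner ℝ e x := hx
            linarith
          · have h1 : ‖h.1‖ ≤ ‖h.1 - (2 * r) • e‖ + ‖(2 * r) • e‖ := by
              simpa using norm_add_le (h.1 - (2 * r) • e) ((2 * r) • e)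
            rw [norm_smul, he, Real.norm_eq_abs, abs_of_pos (by positivity)] at h1
            linarith
      _ = _ := by
          rw [setLIntegral_const, ← mul_assoc, ← mul_assoc,
            show (36 : ℝ) * r ^ 2 = 2 * (18 * r ^ 2) by ring,
            ENNReal.ofReal_mul (p := 2) (by norm_num), ENNReal.ofReal_ofNat]
  exact (ENNReal.mul_le_mul_iff_left hB0 hBt).1 hmain

theorem exists_volume_ball_prod_ball_eq (m k : ℕ) (γ : ℝ) :
    ∃ c : ℝ, 0 < c ∧ ∀ (x : Em m) (r : ℝ), 0 < r →
      volume (Metric.ball x r ×ˢ Metric.ball (0 : Em k) (r ^ (1 + γ))) =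
        ENNReal.ofReal (c * r ^ ((m : ℝ) + (γ + 1) * k)) := by
  have h1 : volume (Metric.ball (0 : Em m) 1) ≠ ⊤ := measure_ball_lt_top.ne
  have h2 : volume (Metric.ball (0 : Em k) 1) ≠ ⊤ := measure_ball_lt_top.ne
  refine ⟨(volume (Metric.ball (0 : Em m) 1)).toReal * (volume (Metric.ball (0 : Em k) 1)).toReal,
    mul_pos (ENNReal.toReal_pos (Metric.measure_ball_pos _ _ one_pos).ne' h1)
      (ENNReal.toReal_pos (Metric.measure_ball_pos _ _ one_pos).ne' h2), fun x r hr => ?_⟩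
  rw [Measure.volume_eq_prod, Measure.prod_prod, Measure.addHaar_ball_of_pos _ _ hr,
    Measure.addHaar_ball_of_pos _ _ (Real.rpow_pos_of_pos hr _), finrank_euclideanSpace_fin,
    finrank_euclideanSpace_fin, ENNReal.ofReal_mul (by positivity),
    ENNReal.ofReal_mul (by positivity), ENNReal.ofReal_toReal h1, ENNReal.ofReal_toReal h2,
    Real.rpow_add hr (m : ℝ), Real.rpow_natCast, ENNReal.ofReal_mul (by positivity)]
  have : (r ^ (1 + γ)) ^ k = r ^ ((γ + 1) * k) := by
    rw [← Real.rpow_natCast, ← Real.rpow_mul hr.le, add_comm]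
  rw [this]
  ring

/-- The weak form of the Sobolev inequality for the Grushin gradient. -/
theorem exists_measure_one_le_abs_le (hm : 1 ≤ m) (k : ℕ) {γ : ℝ} (hγ : 0 < γ) :
    ∃ K : ℝ, 0 < K ∧ ∀ u : Em m × Em k → ℝ, ContDiff ℝ 1 u → volume {z | u z ≠ 0} ≠ ⊤ →
      volume {z | 1 ≤ |u z|} ≤ ENNReal.ofReal K *
        volume {z | u z ≠ 0} ^ (2 / ((m : ℝ) + (γ + 1) * k)) *
          ∫⁻ z, ENNReal.ofReal (grushinSq γ u z) := by
  obtain ⟨c, hc, hvol⟩ := exists_volume_ball_prod_ball_eq m k γ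
  set N : ℝ := (m : ℝ) + (γ + 1) * k
  have hN : 0 < N := by
    have : (1 : ℝ) ≤ m := by exact_mod_cast hm
    positivity
  have : Nonempty (Fin m) := ⟨⟨0, hm⟩⟩
  obtain ⟨e, he⟩ : ∃ e : Em m, ‖e‖ = 1 := exists_norm_eq (Em m) zero_le_one
  refine ⟨72 * (2 / c) ^ (2 / N), by positivity, fun u hu ha => ?_⟩
  rcases eq_or_ne (volume {z | u z ≠ 0}) 0 with h0 | h0
  · have : volume {z | 1 ≤ |u z|} = 0 := by
      refine measure_mono_null (fun z (hz : 1 ≤ |u z|) => ?_) h0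
      intro h
      rw [h] at hz
      norm_num at hz
    rw [this]
    exact zero_le
  set a : ℝ := (volume {z | u z ≠ 0}).toReal
  have haS : volume {z | u z ≠ 0} = ENNReal.ofReal a := (ENNReal.ofReal_toReal ha).symm
  have hapos : 0 < a := ENNReal.toReal_pos h0 ha
  set r : ℝ := (2 / c * a) ^ (1 / N)
  have hr : 0 < r := by positivity
  have hrN : c * r ^ N = 2 * a := by
    rw [← Real.rpow_mul (by positivity), one_div_mul_cancel hN.ne', Real.rpow_one]
    field_simp
  have hr2 : r ^ 2 = (2 / c) ^ (2 / N) * a ^ (2 / N) := by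
    rw [← Real.mul_rpow (by positivity) hapos.le, ← Real.rpow_natCast,
      ← Real.rpow_mul (by positivity)]
    congr 1
    push_cast
    ring
  have hB : ∀ e : Em m, 2 * volume {z | u z ≠ 0} ≤ volume
      (Metric.ball ((2 * r) • e) r ×ˢ Metric.ball (0 : Em k) (r ^ (1 + γ))) := by
    intro e
    rw [hvol _ _ hr, hrN, haS, ENNReal.ofReal_mul two_pos.le, ENNReal.ofReal_ofNat]
  have h1 := measure_one_le_abs_inter_halfSpace_le hu hγ hr he (hB e)
  have h2 := measure_one_le_abs_inter_halfSpace_le hu hγ hr (norm_neg e ▸ he) (hB (-e))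
  calc volume {z | 1 ≤ |u z|}
      ≤ volume ({z | 1 ≤ |u z|} ∩ {x | 0 ≤ inner ℝ e x} ×ˢ Set.univ ∪
          {z | 1 ≤ |u z|} ∩ {x | 0 ≤ inner ℝ (-e) x} ×ˢ Set.univ) := by
        refine measure_mono fun z hz => ?_
        rcases le_total 0 (inner ℝ e z.1) with h | h
        · exact Or.inl ⟨hz, h, trivial⟩
        · refine Or.inr ⟨hz, ?_, trivial⟩
          simpa [inner_neg_left] using h
    _ ≤ _ := measure_union_le _ _
    _ ≤ _ := add_le_add h1 h2
    _ = _ := by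
        rw [← add_mul, ← ENNReal.ofReal_add (by positivity) (by positivity), haS,
          ENNReal.ofReal_rpow_of_pos hapos, ← ENNReal.ofReal_mul (by positivity), hr2]
        congr 2
        ring

theorem gradient_comp_eq_smul {F : Type*} [NormedAddCommGroup F] [InnerProductSpace ℝ F]
    [CompleteSpace F] {ψ : ℝ → ℝ} {f : F → ℝ} {x : F} (hψ : DifferentiableAt ℝ ψ (f x))
    (hf : DifferentiableAt ℝ f x) :
    gradient (fun x => ψ (f x)) x = deriv ψ (f x) • gradient f x := by
  have h : HasFDerivAt (fun x => ψ (f x)) _ x := hψ.hasDerivAt.comp_hasFDerivAt x hf.hasFDerivAt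
  rw [gradient, gradient, h.fderiv]
  simp

theorem grushinSq_comp_eq {ψ : ℝ → ℝ} (hψ : ContDiff ℝ 1 ψ) (hu : ContDiff ℝ 1 u) (γ : ℝ)
    (z : Em m × Em k) :
    grushinSq γ (fun z => ψ (u z)) z = deriv ψ (u z) ^ 2 * grushinSq γ u z := by
  have hx : gradX (fun z => ψ (u z)) z = deriv ψ (u z) • gradX u z :=
    gradient_comp_eq_smul (hψ.differentiable one_ne_zero _)
      ((contDiff_slice_fst hu z.2).differentiable one_ne_zero _)
  have hy : gradY (fun z => ψ (u z)) z = deriv ψ (u z) • gradY u z :=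
    gradient_comp_eq_smul (hψ.differentiable one_ne_zero _)
      ((contDiff_slice_snd hu z.1).differentiable one_ne_zero _)
  rw [grushinSq, grushinSq, hx, hy, norm_smul, norm_smul, mul_pow, mul_pow, Real.norm_eq_abs,
    sq_abs]
  ring

/-- Smooth truncations at every height, with a scale-invariant gradient bound. -/
theorem exists_truncation : ∃ L : ℝ, 0 < L ∧ ∀ lam : ℝ, 0 < lam → ∃ ψ : ℝ → ℝ, ContDiff ℝ 1 ψ ∧
    (∀ s, |s| ≤ lam → ψ s = 0) ∧ (∀ s, 2 * lam ≤ |s| → ψ s = 1) ∧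
    (∀ s, |deriv ψ s| ≤ L / lam) ∧ (∀ s, |s| ∉ Set.Ico lam (2 * lam) → deriv ψ s = 0) := by
  set φ : ℝ → ℝ := fun s => Real.smoothTransition ((s ^ 2 - 1) / 3) with hφ
  have hφc : ContDiff ℝ 1 φ := by
    refine Real.smoothTransition.contDiff.comp ?_
    fun_prop
  have hφ0 : ∀ s, |s| ≤ 1 → φ s = 0 := fun s hs => by
    apply Real.smoothTransition.zero_of_nonpos
    have := (sq_le_one_iff_abs_le_one s).2 hs
    linarith
  have hφ1 : ∀ s, 2 ≤ |s| → φ s = 1 := fun s hs => by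
    apply Real.smoothTransition.one_of_one_le
    rw [le_div_iff₀ (by norm_num), ← sq_abs]
    nlinarith
  have hd : ∀ s, |s| ∉ Set.Ico 1 2 → deriv φ s = 0 := fun s hs => by
    rw [Set.mem_Ico, not_and_or, not_le, not_lt] at hs
    rcases hs with hs | hs
    · refine IsLocalMin.deriv_eq_zero (Eventually.of_forall fun t => ?_)
      rw [hφ0 s hs.le]
      exact Real.smoothTransition.nonneg _
    · refine IsLocalMax.deriv_eq_zero (Eventually.of_forall fun t => ?_)
      rw [hφ1 s hs]
      exact Real.smoothTransition.le_one _
  obtain ⟨M, hM⟩ := (isCompact_Icc (a := (-2 : ℝ)) (b := 2)).exists_bound_of_continuousOn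
    (hφc.continuous_deriv le_rfl).continuousOn
  have hM' : ∀ s, |deriv φ s| ≤ max M 1 := fun s => by
    by_cases hs : |s| ∈ Set.Ico (1 : ℝ) 2
    · exact (hM s (abs_le.1 hs.2.le)).trans (le_max_left _ _)
    · rw [hd s hs, abs_zero]
      exact zero_le_one.trans (le_max_right _ _)
  refine ⟨max M 1, lt_max_of_lt_right one_pos, fun lam hl => ⟨fun s => φ (lam⁻¹ * s), ?_, ?_, ?_, ?_⟩⟩
  · exact hφc.comp (contDiff_const.mul contDiff_id)
  · intro s hs
    apply hφ0
    rw [abs_mul, abs_of_pos (inv_pos.2 hl), inv_mul_le_iff₀ hl, mul_one]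
    exact hs
  · intro s hs
    apply hφ1
    rw [abs_mul, abs_of_pos (inv_pos.2 hl), le_inv_mul_iff₀ hl, mul_comm]
    exact hs
  have hder : ∀ s, deriv (fun s => φ (lam⁻¹ * s)) s = lam⁻¹ * deriv φ (lam⁻¹ * s) := fun s => by
    rw [deriv_comp_mul_left, smul_eq_mul]
  constructor
  · intro s
    rw [hder, abs_mul, abs_of_pos (inv_pos.2 hl), div_eq_inv_mul]
    exact mul_le_mul_of_nonneg_left (hM' _) (inv_pos.2 hl).le
  · intro s hs
    rw [hder, hd, mul_zero]
    contrapose! hs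
    rw [abs_mul, abs_of_pos (inv_pos.2 hl), Set.mem_Ico, le_inv_mul_iff₀ hl,
      inv_mul_lt_iff₀ hl, mul_one, mul_comm] at hs
    exact hs

theorem exists_measure_two_mul_le_abs_le (hm : 1 ≤ m) (k : ℕ) {γ : ℝ} (hγ : 0 < γ) :
    ∃ K : ℝ, 0 < K ∧ ∀ u : Em m × Em k → ℝ, ContDiff ℝ 1 u → ∀ lam : ℝ, 0 < lam →
      volume {z | lam ≤ |u z|} ≠ ⊤ →
      volume {z | 2 * lam ≤ |u z|} ≤ ENNReal.ofReal (K * (lam ^ 2)⁻¹) *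
        volume {z | lam ≤ |u z|} ^ (2 / ((m : ℝ) + (γ + 1) * k)) *
          ∫⁻ z in {z | |u z| ∈ Set.Ico lam (2 * lam)}, ENNReal.ofReal (grushinSq γ u z) := by
  obtain ⟨K, hK, hweak⟩ := exists_measure_one_le_abs_le hm k hγ
  obtain ⟨L, hL, htrunc⟩ := exists_truncation
  refine ⟨K * L ^ 2, by positivity, fun u hu lam hl hfin => ?_⟩
  obtain ⟨ψ, hψ, hψ0, hψ1, hψb, hψd⟩ := htrunc lam hl
  have hsub : {z | ψ (u z) ≠ 0} ⊆ {z | lam ≤ |u z|} := fun z hz => by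
    by_contra h
    exact hz (hψ0 _ (not_le.1 h).le)
  have h1 := hweak (fun z => ψ (u z)) (hψ.comp hu) (measure_ne_top_of_subset hsub hfin)
  have hset : MeasurableSet {z | |u z| ∈ Set.Ico lam (2 * lam)} :=
    hu.continuous.abs.measurable measurableSet_Ico
  have h2 : ∫⁻ z, ENNReal.ofReal (grushinSq γ (fun z => ψ (u z)) z) ≤
      ENNReal.ofReal (L ^ 2 * (lam ^ 2)⁻¹) *
      ∫⁻ z in {z | |u z| ∈ Set.Ico lam (2 * lam)}, ENNReal.ofReal (grushinSq γ u z) := by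
    rw [← lintegral_const_mul' _ _ ENNReal.ofReal_ne_top, ← lintegral_indicator hset]
    refine lintegral_mono fun z => ?_
    rw [grushinSq_comp_eq hψ hu]
    by_cases hz : |u z| ∈ Set.Ico lam (2 * lam)
    · rw [Set.indicator_of_mem (by exact hz), ← ENNReal.ofReal_mul (by positivity)]
      apply ENNReal.ofReal_le_ofReal
      refine mul_le_mul_of_nonneg_right ?_ (grushinSq_nonneg γ u z)
      rw [← sq_abs, ← div_eq_mul_inv, ← div_pow]
      exact pow_le_pow_left₀ (abs_nonneg _) (hψb _) 2
    · rw [hψd _ hz]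
      simp
  have hN : 0 ≤ (m : ℝ) + (γ + 1) * k := by positivity
  calc volume {z | 2 * lam ≤ |u z|} ≤ volume {z | 1 ≤ |ψ (u z)|} := by
        refine measure_mono fun z hz => ?_
        exact (by rw [hψ1 _ hz, abs_one] : (1 : ℝ) ≤ |ψ (u z)|)
    _ ≤ _ := h1
    _ ≤ ENNReal.ofReal K * volume {z | lam ≤ |u z|} ^ (2 / ((m : ℝ) + (γ + 1) * k)) *
        (ENNReal.ofReal (L ^ 2 * (lam ^ 2)⁻¹) *
          ∫⁻ z in {z | |u z| ∈ Set.Ico lam (2 * lam)}, ENNReal.ofReal (grushinSq γ u z)) := by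
        gcongr
    _ = _ := by
        rw [mul_assoc K, ENNReal.ofReal_mul hK.le]
        ring

theorem lintegral_abs_rpow_lt_top (hu : Continuous u) (hs : HasCompactSupport u) {q : ℝ}
    (hq : 0 < q) : ∫⁻ z, ENNReal.ofReal (|u z| ^ q) < ⊤ := by
  have hc : Continuous fun z => |u z| ^ q := hu.abs.rpow_const fun _ => Or.inr hq.le
  have hcs : HasCompactSupport fun z => |u z| ^ q :=
    hs.comp_left (g := fun s => |s| ^ q) (by simp [hq.ne'])
  have hi : Integrable (fun z => |u z| ^ q) volume := hc.integrable_of_hasCompactSupport hcs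
  exact hi.lintegral_lt_top

/-- The critical Sobolev inequality for the Grushin gradient. -/
theorem exists_lintegral_abs_rpow_twoStar_le (hm : 1 ≤ m) (hN : 3 ≤ m + k) {γ : ℝ}
    (hγ : 0 < γ) :
    ∃ K : ℝ, 0 < K ∧ ∀ u : Em m × Em k → ℝ, ContDiff ℝ 1 u → HasCompactSupport u →
      ∫⁻ z, ENNReal.ofReal (|u z| ^ twoStar m k γ) ≤
        ENNReal.ofReal K * (∫⁻ z, ENNReal.ofReal (grushinSq γ u z)) ^ (twoStar m k γ / 2) := by
  obtain ⟨K, hK, hweak⟩ := exists_measure_two_mul_le_abs_le hm k hγ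
  rw [twoStar]
  set N : ℝ := (m : ℝ) + (γ + 1) * k
  have hN2 : 2 < N := by
    have h1 : (3 : ℝ) ≤ (m : ℝ) + k := by exact_mod_cast hN
    have h2 : 0 ≤ γ * k := by positivity
    simp only [N]
    linarith
  set q : ℝ := 2 * N / (N - 2) with hqdef
  have hN2' : 0 < N - 2 := by linarith
  have hq : 0 < q := by positivity
  have hqθ : q * (2 / N) = q - 2 := by
    rw [hqdef]; field_simp; ring
  have hθ : 0 < 2 / N := by positivity
  refine ⟨(2 ^ q * (2 ^ q * K)) ^ (q / 2), by positivity, fun u hu hs => ?_⟩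
  have hc := hu.continuous
  have hT := lintegral_abs_rpow_lt_top hc hs hq
  set T := ∫⁻ z, ENNReal.ofReal (|u z| ^ q)
  set E := ∫⁻ z, ENNReal.ofReal (grushinSq γ u z)
  have hpow : ∀ j : ℤ, (0 : ℝ) < 2 ^ j := fun j => by positivity
  have hmeas : Measurable fun z => ENNReal.ofReal (|u z| ^ q) :=
    (hc.abs.rpow_const fun _ => Or.inr hq.le).measurable.ennreal_ofReal
  have hmark : ∀ lam : ℝ, 0 < lam →
      ENNReal.ofReal (lam ^ q) * volume {z | lam ≤ |u z|} ≤ T := fun lam hl => by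
    refine le_trans ?_ (mul_meas_ge_le_lintegral hmeas (ENNReal.ofReal (lam ^ q)))
    refine mul_le_mul_right (measure_mono fun z hz => ?_) _
    exact ENNReal.ofReal_le_ofReal (Real.rpow_le_rpow hl.le hz hq.le)
  have hfin : ∀ lam : ℝ, 0 < lam → volume {z | lam ≤ |u z|} ≠ ⊤ := fun lam hl h => by
    have h1 := (hmark lam hl).trans_lt hT
    rw [h, ENNReal.mul_top (by simpa using Real.rpow_pos_of_pos hl q)] at h1
    exact lt_irrefl _ h1
  set A : ℤ → Set (Em m × Em k) := fun j => {z | |u z| ∈ Set.Ico ((2 : ℝ) ^ j) (2 * 2 ^ j)}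
   
  have hAm : ∀ j, MeasurableSet (A j) := fun j => hc.abs.measurable measurableSet_Ico
  have hAd : Pairwise (Function.onFun Disjoint A) := by
    have h1 := (zpow_right_strictMono₀ (one_lt_two (α := ℝ))).monotone.pairwise_disjoint_on_Ico_succ
    intro i j hij
    have h2 := h1 hij
    simp only [Function.onFun, Order.succ_eq_add_one, zpow_add_one₀ (two_ne_zero (α := ℝ)),
      mul_comm _ (2 : ℝ)] at h2
    exact h2.preimage fun z => |u z|
  have hlevel : ∀ j : ℤ, ENNReal.ofReal ((2 * 2 ^ j) ^ q) * volume {z | (2 : ℝ) * 2 ^ j ≤ |u z|} ≤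
      ENNReal.ofReal (2 ^ q * K) * T ^ (2 / N) *
        ∫⁻ z in A j, ENNReal.ofReal (grushinSq γ u z) := fun j => by
    have hlam := hpow j
    have h1 := hweak u hu (2 ^ j) hlam (hfin _ hlam)
    have h2 : (2 * (2 : ℝ) ^ j) ^ q * (K * (((2 : ℝ) ^ j) ^ 2)⁻¹) =
        2 ^ q * K * (((2 : ℝ) ^ j) ^ q) ^ (2 / N) := by
      rw [Real.mul_rpow two_pos.le hlam.le, ← Real.rpow_mul hlam.le, hqθ, Real.rpow_sub hlam,
        Real.rpow_two]
      field_simp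
    calc _ ≤ ENNReal.ofReal ((2 * 2 ^ j) ^ q) * (ENNReal.ofReal (K * (((2 : ℝ) ^ j) ^ 2)⁻¹) *
          volume {z | (2 : ℝ) ^ j ≤ |u z|} ^ (2 / N) *
            ∫⁻ z in A j, ENNReal.ofReal (grushinSq γ u z)) := by gcongr
      _ = ENNReal.ofReal (2 ^ q * K) * (ENNReal.ofReal (((2 : ℝ) ^ j) ^ q) *
          volume {z | (2 : ℝ) ^ j ≤ |u z|}) ^ (2 / N) *
            ∫⁻ z in A j, ENNReal.ofReal (grushinSq γ u z) := by
          rw [← mul_assoc, ← mul_assoc, ← ENNReal.ofReal_mul (by positivity), h2,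
            ENNReal.ofReal_mul (by positivity), ENNReal.mul_rpow_of_nonneg _ _ hθ.le,
            ENNReal.ofReal_rpow_of_pos (by positivity)]
          ring
      _ ≤ _ := by
          gcongr
          exact hmark _ hlam
  have hEsum : ∑' j, ∫⁻ z in A j, ENNReal.ofReal (grushinSq γ u z) ≤ E := by
    rw [← lintegral_iUnion hAm hAd]
    exact setLIntegral_le_lintegral _ _
  have hTsum : T ≤ ∑' j : ℤ, ENNReal.ofReal ((2 * 2 ^ j) ^ q) * volume {z | (2 : ℝ) ^ j ≤ |u z|} := by
    calc T ≤ ∫⁻ z, ∑' j : ℤ, {z | (2 : ℝ) ^ j ≤ |u z|}.indicator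
          (fun _ => ENNReal.ofReal ((2 * (2 : ℝ) ^ j) ^ q)) z := by
          refine lintegral_mono fun z => ?_
          rcases (abs_nonneg (u z)).eq_or_lt with h0 | h0
          · simp [← h0, hq.ne']
          obtain ⟨j, hj1, hj2⟩ := exists_mem_Ico_zpow h0 (one_lt_two (α := ℝ))
          refine le_trans ?_ (ENNReal.le_tsum j)
          rw [Set.indicator_of_mem (by exact hj1)]
          apply ENNReal.ofReal_le_ofReal
          rw [zpow_add_one₀ two_ne_zero, mul_comm] at hj2
          gcongr
      _ = _ := by
          have hm' : ∀ j : ℤ, MeasurableSet {z | (2 : ℝ) ^ j ≤ |u z|} := fun j =>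
            hc.abs.measurable measurableSet_Ici
          rw [lintegral_tsum fun j => (measurable_const.indicator (hm' j)).aemeasurable]
          congr 1 with j
          rw [lintegral_indicator_const (hm' j)]
  have hclosed : T ≤ ENNReal.ofReal (2 ^ q * (2 ^ q * K)) * E * T ^ (2 / N) := by
    rw [← (Equiv.addRight (1 : ℤ)).tsum_eq] at hTsum
    calc T ≤ _ := hTsum
      _ ≤ ∑' j : ℤ, ENNReal.ofReal (2 ^ q) * (ENNReal.ofReal (2 ^ q * K) * T ^ (2 / N) *
          ∫⁻ z in A j, ENNReal.ofReal (grushinSq γ u z)) := by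
          refine ENNReal.tsum_le_tsum fun j => ?_
          refine le_trans (le_of_eq ?_) (mul_le_mul_right (hlevel j) _)
          have : (2 : ℝ) ^ (Equiv.addRight 1 j) = 2 * 2 ^ j := by
            rw [Equiv.coe_addRight, zpow_add_one₀ two_ne_zero, mul_comm]
          rw [this, Real.mul_rpow two_pos.le (by positivity), ENNReal.ofReal_mul (by positivity),
            mul_assoc]
      _ = ENNReal.ofReal (2 ^ q) * (ENNReal.ofReal (2 ^ q * K) * T ^ (2 / N) *
          ∑' j, ∫⁻ z in A j, ENNReal.ofReal (grushinSq γ u z)) := by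
          rw [ENNReal.tsum_mul_left, ENNReal.tsum_mul_left]
      _ ≤ ENNReal.ofReal (2 ^ q) * (ENNReal.ofReal (2 ^ q * K) * T ^ (2 / N) * E) := by gcongr
      _ = _ := by
          rw [ENNReal.ofReal_mul (p := 2 ^ q) (q := 2 ^ q * K) (by positivity)]
          ring
  rcases eq_or_ne T 0 with h0 | h0
  · rw [h0]
    exact zero_le
  have hTθ0 : T ^ (2 / N) ≠ 0 := (ENNReal.rpow_pos (pos_iff_ne_zero.2 h0) hT.ne).ne'
  have hTθt : T ^ (2 / N) ≠ ⊤ := ENNReal.rpow_ne_top_of_nonneg hθ.le hT.ne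
  have h1 : T ^ (q / 2)⁻¹ ≤ ENNReal.ofReal (2 ^ q * (2 ^ q * K)) * E := by
    have h2 : T ^ (q / 2)⁻¹ * T ^ (2 / N) = T := by
      rw [← ENNReal.rpow_add _ _ h0 hT.ne]
      have : (q / 2)⁻¹ + 2 / N = 1 := by
        rw [hqdef]; field_simp; ring
      rw [this, ENNReal.rpow_one]
    rw [← ENNReal.mul_le_mul_iff_left hTθ0 hTθt, h2]
    exact hclosed
  rw [ENNReal.rpow_inv_le_iff (by positivity), ENNReal.mul_rpow_of_nonneg _ _ (by positivity),
    ENNReal.ofReal_rpow_of_pos (by positivity)] at h1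
  exact h1

theorem two_lt_twoStar (hN : 3 ≤ m + k) {γ : ℝ} (hγ : 0 < γ) : 2 < twoStar m k γ := by
  have h1 : (3 : ℝ) ≤ (m : ℝ) + k := by exact_mod_cast hN
  have h2 : 0 ≤ γ * k := by positivity
  rw [twoStar, lt_div_iff₀ (by linarith)]
  linarith

end Grushin

theorem weight_mul_rpow_le_interpolation {V Q w s α β C_V C_Q p q t : ℝ} (hw : 1 ≤ w)
    (hCV : 0 < C_V) (hCQ : 0 < C_Q) (hα : 0 ≤ α) (hαβ : α ≤ β) (hV : C_V / w ^ α ≤ V)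
    (hQ : Q ≤ C_Q / w ^ β) (hq : 0 ≤ q) (ht0 : 0 ≤ t) (ht1 : t ≤ 1)
    (hp : p = 2 * (1 - t) + q * t) :
    Q * |s| ^ p ≤ C_Q / C_V ^ (1 - t) * ((V * s ^ 2) ^ (1 - t) * (|s| ^ q) ^ t) := by
  have hw0 : 0 < w := one_pos.trans_le hw
  have h1t : 0 ≤ 1 - t := sub_nonneg.2 ht1
  have hV0 : 0 ≤ V := le_trans (by positivity) hV
  have hs : |s| ^ p = (s ^ 2) ^ (1 - t) * (|s| ^ q) ^ t := by
    rw [hp, Real.rpow_add_of_nonneg (abs_nonneg s) (by positivity) (by positivity),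
      Real.rpow_mul (abs_nonneg s), Real.rpow_mul (abs_nonneg s), Real.rpow_two, sq_abs]
  have hQV : Q ≤ C_Q / C_V ^ (1 - t) * V ^ (1 - t) := by
    calc Q ≤ C_Q / w ^ β := hQ
      _ ≤ C_Q / w ^ (α * (1 - t)) := by
          gcongr
          nlinarith
      _ = C_Q / C_V ^ (1 - t) * (C_V / w ^ α) ^ (1 - t) := by
          rw [Real.div_rpow hCV.le (by positivity), ← Real.rpow_mul hw0.le]
          have : C_V ^ (1 - t) ≠ 0 := (Real.rpow_pos_of_pos hCV _).ne'
          field_simp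
      _ ≤ _ := by gcongr
  rw [hs, Real.mul_rpow hV0 (sq_nonneg s)]
  calc Q * ((s ^ 2) ^ (1 - t) * (|s| ^ q) ^ t)
      ≤ C_Q / C_V ^ (1 - t) * V ^ (1 - t) * ((s ^ 2) ^ (1 - t) * (|s| ^ q) ^ t) :=
        mul_le_mul_of_nonneg_right hQV (by positivity)
    _ = _ := by ring

/-- Weighted Sobolev embedding, case (ii): under (V), (Q) with
`N < α < β` and `2 ≤ p ≤ p̄ = min{2(β-N)/(α-N), 2*_γ}`, there is `C > 0` with
`(∫ Q|u|^p)^{1/p} ≤ C ‖u‖_{E_V^γ}` for all `u ∈ C_c^∞(ℝ^N)`. -/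
theorem weighted_embedding_case_ii (m k : ℕ) (hm : 1 ≤ m) (hk : 1 ≤ k) (hN : 3 ≤ m + k)
    (γ : ℝ) (hγ : 0 < γ)
    (V Q : Em m × Em k → ℝ) (hVmeas : Measurable V) (hQmeas : Measurable Q)
    (C_V C_Q α β : ℝ) (hCV : 0 < C_V) (hCQ : 0 < C_Q)
    (hV : ∀ᵐ z ∂(volume : Measure (Em m × Em k)), C_V / (1 + pnorm z) ^ α ≤ V z)
    (hQ : ∀ᵐ z ∂(volume : Measure (Em m × Em k)), 0 < Q z ∧ Q z ≤ C_Q / (1 + pnorm z) ^ β)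
    (hα : ((m : ℝ) + k) < α) (hαβ : α < β)
    (p : ℝ) (hp1 : 2 ≤ p)
    (hp2 : p ≤ min (2 * (β - ((m : ℝ) + k)) / (α - ((m : ℝ) + k))) (twoStar m k γ)) :
    ∃ C : ℝ, 0 < C ∧ ∀ u : Em m × Em k → ℝ, ContDiff ℝ (⊤ : ℕ∞) u → HasCompactSupport u →
      (∫⁻ z, ENNReal.ofReal (Q z * |u z| ^ p)) ^ (1 / p)
        ≤ ENNReal.ofReal C *
          (∫⁻ z, ENNReal.ofReal (grushinSq γ u z + V z * u z ^ 2)) ^ ((1:ℝ) / 2) := by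
  obtain ⟨K, hK, hSob⟩ := exists_lintegral_abs_rpow_twoStar_le hm hN hγ
  have hq2 : 2 < twoStar m k γ := two_lt_twoStar hN hγ
  have hpq : p ≤ twoStar m k γ := hp2.trans (min_le_right _ _)
  set q := twoStar m k γ
  have hα0 : 0 < α := lt_of_le_of_lt (by positivity) hα
  set t : ℝ := (p - 2) / (q - 2)
  have hq2' : 0 < q - 2 := by linarith
  have ht0 : 0 ≤ t := div_nonneg (by linarith) hq2'.le
  have ht1 : t ≤ 1 := (div_le_one hq2').2 (by linarith)
  have h1t : 0 ≤ 1 - t := sub_nonneg.2 ht1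
  have hpt : p = 2 * (1 - t) + q * t := by
    have : t * (q - 2) = p - 2 := div_mul_cancel₀ _ hq2'.ne'
    linarith
  have hp0 : 0 < p := by linarith
  set M : ℝ := C_Q / C_V ^ (1 - t)
  have hM : 0 < M := by positivity
  refine ⟨(M * K ^ t) ^ (1 / p), by positivity, fun u hu hs => ?_⟩
  have hu1 : ContDiff ℝ 1 u := hu.of_le (by exact_mod_cast le_top)
  have hum : Measurable u := hu1.continuous.measurable
  set I := ∫⁻ z, ENNReal.ofReal (grushinSq γ u z + V z * u z ^ 2)
  have hV0 : ∀ᵐ z, 0 ≤ V z := hV.mono fun z hz => le_trans (by unfold pnorm; positivity) hz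
  have hVI : ∫⁻ z, ENNReal.ofReal (V z * u z ^ 2) ≤ I :=
    lintegral_mono fun z => ENNReal.ofReal_le_ofReal (by linarith [grushinSq_nonneg γ u z])
  have hEI : ∫⁻ z, ENNReal.ofReal (grushinSq γ u z) ≤ I :=
    lintegral_mono_ae (hV0.mono fun z hz =>
      ENNReal.ofReal_le_ofReal (by linarith [mul_nonneg hz (sq_nonneg (u z))]))
  have hmain : ∫⁻ z, ENNReal.ofReal (Q z * |u z| ^ p) ≤
      ENNReal.ofReal (M * K ^ t) * I ^ (p / 2) := by
    calc ∫⁻ z, ENNReal.ofReal (Q z * |u z| ^ p)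
        ≤ ∫⁻ z, ENNReal.ofReal M * (ENNReal.ofReal (V z * u z ^ 2) ^ (1 - t) *
            ENNReal.ofReal (|u z| ^ q) ^ t) := by
          refine lintegral_mono_ae ?_
          filter_upwards [hV, hQ, hV0] with z hz1 hz2 hz3
          have hw : 1 ≤ 1 + pnorm z := le_add_of_nonneg_right (Real.sqrt_nonneg _)
          rw [ENNReal.ofReal_rpow_of_nonneg (by positivity) h1t,
            ENNReal.ofReal_rpow_of_nonneg (by positivity) ht0,
            ← ENNReal.ofReal_mul (by positivity), ← ENNReal.ofReal_mul (by positivity)]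
          exact ENNReal.ofReal_le_ofReal (weight_mul_rpow_le_interpolation hw hCV hCQ hα0.le
            hαβ.le hz1 hz2.2 (by linarith) ht0 ht1 hpt)
      _ = ENNReal.ofReal M * ∫⁻ z, ENNReal.ofReal (V z * u z ^ 2) ^ (1 - t) *
            ENNReal.ofReal (|u z| ^ q) ^ t := lintegral_const_mul' _ _ ENNReal.ofReal_ne_top
      _ ≤ ENNReal.ofReal M * ((∫⁻ z, ENNReal.ofReal (V z * u z ^ 2)) ^ (1 - t) *
            (∫⁻ z, ENNReal.ofReal (|u z| ^ q)) ^ t) := by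
          gcongr
          exact ENNReal.lintegral_mul_norm_pow_le (by fun_prop) (by fun_prop) h1t ht0 (by ring)
      _ ≤ ENNReal.ofReal M * (I ^ (1 - t) * (ENNReal.ofReal K * I ^ (q / 2)) ^ t) := by
          gcongr
          refine (hSob u hu1 hs).trans ?_
          gcongr
      _ = _ := by
          rw [ENNReal.mul_rpow_of_nonneg _ _ ht0, ENNReal.ofReal_rpow_of_pos hK,
            ← ENNReal.rpow_mul, ENNReal.ofReal_mul hM.le,
            show p / 2 = (1 - t) + q / 2 * t by rw [hpt]; ring,
            ENNReal.rpow_add_of_nonneg _ _ h1t (by positivity)]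
          ring
  calc _ ≤ (ENNReal.ofReal (M * K ^ t) * I ^ (p / 2)) ^ (1 / p) := by gcongr
    _ = _ := by
        rw [ENNReal.mul_rpow_of_nonneg _ _ (by positivity),
          ENNReal.ofReal_rpow_of_pos (by positivity), ← ENNReal.rpow_mul]
        congr 2
        field_simp
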